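/- Let α > 0, let γ be the Euler–Mascheroni constant, and let μ(t, β) = ∫_0^∞ t^x x^β / (Γ(β+1) Γ(x+1)) dx for β > −1, t > 0. Then for every real s > e^(−(1+γ)), ∫_0^∞ e^(−s·u) μ(e^(−(1+γ))·u, α−1) du = 1/(s · (1 + γ + ln s)^α). In particular u ↦ μ(e^(−(1+γ))u, α−1) is the inverse Laplace transform of the distribution-function transform 1/(s · ln^α(e^(1+γ) s)) arising from the shot noise with Gamma(α)-distributed parameter A = Λ/B. -/

import Mathlib

open MeasureTheory

/-- The Volterra function `μ(t, β) = ∫_0^∞ t^x x^β / (Γ(β+1) Γ(x+1)) dx`. -/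
noncomputable def volterraMu (t β : ℝ) : ℝ :=
  ∫ x in Set.Ioi (0:ℝ), t ^ x * x ^ β / (Real.Gamma (β + 1) * Real.Gamma (x + 1))

open Set

theorem integrableOn_rpow_mul_exp_neg_mul_Ioi {a r : ℝ} (ha : 0 < a) (hr : 0 < r) :
    IntegrableOn (fun t : ℝ => t ^ (a - 1) * Real.exp (-(r * t))) (Ioi 0) := by
  refine not_imp_comm.1 integral_undef ?_
  rw [Real.integral_rpow_mul_exp_neg_mul_Ioi ha hr]
  have := Real.Gamma_pos_of_pos ha
  positivity

/-- The integrand of the double integral computing the Laplace transform of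
`u ↦ volterraMu (c * u) (α - 1)`. -/
noncomputable def volterraKernel (α c s x u : ℝ) : ℝ :=
  Real.exp (-s * u) * ((c * u) ^ x * x ^ (α - 1) / (Real.Gamma (α - 1 + 1) * Real.Gamma (x + 1)))

theorem volterraKernel_nonneg {α c s x u : ℝ} (hα : 0 < α) (hc : 0 < c) (hx : 0 < x)
    (hu : 0 < u) : 0 ≤ volterraKernel α c s x u := by
  have h₁ : 0 < Real.Gamma (α - 1 + 1) := Real.Gamma_pos_of_pos (by linarith)
  have h₂ : 0 < Real.Gamma (x + 1) := Real.Gamma_pos_of_pos (by linarith)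
  unfold volterraKernel
  positivity

theorem volterraKernel_eq {α c s x u : ℝ} (hc : 0 < c) (hu : 0 < u) :
    volterraKernel α c s x u =
      c ^ x * x ^ (α - 1) / (Real.Gamma α * Real.Gamma (x + 1)) *
        (u ^ (x + 1 - 1) * Real.exp (-(s * u))) := by
  rw [volterraKernel, Real.mul_rpow hc.le hu.le, sub_add_cancel, add_sub_cancel_right, neg_mul]
  ring

theorem integrableOn_volterraKernel {α c s x : ℝ} (hc : 0 < c) (hs : 0 < s) (hx : 0 < x) :
    IntegrableOn (volterraKernel α c s x) (Ioi 0) :=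
  IntegrableOn.congr_fun
    ((integrableOn_rpow_mul_exp_neg_mul_Ioi (by linarith : 0 < x + 1) hs).const_mul _)
    (fun _ hu => (volterraKernel_eq hc hu).symm) measurableSet_Ioi

theorem integral_volterraKernel {α c s x : ℝ} (hc : 0 < c) (hs : 0 < s) (hx : 0 < x) :
    ∫ u in Ioi (0:ℝ), volterraKernel α c s x u =
      1 / (s * Real.Gamma α) * (x ^ (α - 1) * Real.exp (-(Real.log (s / c) * x))) := by
  rw [setIntegral_congr_fun measurableSet_Ioi fun _ hu => volterraKernel_eq hc hu,
    integral_const_mul, Real.integral_rpow_mul_exp_neg_mul_Ioi (by linarith) hs]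
  have hΓ : Real.Gamma (x + 1) ≠ 0 := (Real.Gamma_pos_of_pos (by linarith)).ne'
  have he : Real.exp (-(Real.log (s / c) * x)) = c ^ x * (1 / s) ^ x := by
    rw [← Real.mul_rpow hc.le (by positivity), mul_one_div,
      Real.rpow_def_of_pos (div_pos hc hs), ← inv_div s c, Real.log_inv, neg_mul]
  rw [he, Real.rpow_add_one (by positivity)]
  field_simp

theorem continuousOn_volterraKernel {α c s : ℝ} (hα : 0 < α) (hc : 0 < c) :
    ContinuousOn (Function.uncurry (volterraKernel α c s)) (Ioi 0 ×ˢ Ioi 0) := by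
  rintro ⟨x, u⟩ ⟨hx : 0 < x, hu : 0 < u⟩
  apply ContinuousAt.continuousWithinAt
  have hx' : 0 < x + 1 := by linarith
  have hΓ : ContinuousAt (fun p : ℝ × ℝ => Real.Gamma (p.1 + 1)) (x, u) :=
    ContinuousAt.comp (f := fun p : ℝ × ℝ => p.1 + 1) (g := Real.Gamma)
      (Real.differentiableAt_Gamma fun m => by
        have : (0:ℝ) ≤ m := m.cast_nonneg
        dsimp only
        linarith).continuousAt (by fun_prop)
  have h₁ : ContinuousAt (fun p : ℝ × ℝ => (c * p.2) ^ p.1) (x, u) :=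
    ContinuousAt.rpow (by fun_prop) (by fun_prop) (Or.inl (mul_pos hc hu).ne')
  have h₂ : ContinuousAt (fun p : ℝ × ℝ => p.1 ^ (α - 1)) (x, u) :=
    ContinuousAt.rpow (by fun_prop) (by fun_prop) (Or.inl hx.ne')
  have he : ContinuousAt (fun p : ℝ × ℝ => Real.exp (-s * p.2)) (x, u) := by fun_prop
  have hΓα : Real.Gamma (α - 1 + 1) ≠ 0 := (Real.Gamma_pos_of_pos (by linarith)).ne'
  exact he.mul ((h₁.mul h₂).div (continuousAt_const.mul hΓ)
    (mul_ne_zero hΓα (Real.Gamma_pos_of_pos hx').ne'))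

theorem integrable_uncurry_volterraKernel {α c s : ℝ} (hα : 0 < α) (hc : 0 < c) (hs : c < s) :
    Integrable (Function.uncurry (volterraKernel α c s))
      ((volume.restrict (Ioi 0)).prod (volume.restrict (Ioi 0))) := by
  have hs₀ : 0 < s := hc.trans hs
  have hL : 0 < Real.log (s / c) := Real.log_pos ((one_lt_div hc).2 hs)
  rw [integrable_prod_iff]
  · refine ⟨(ae_restrict_iff' measurableSet_Ioi).2 <|
      .of_forall fun x hx => integrableOn_volterraKernel hc hs₀ hx, ?_⟩
    refine IntegrableOn.congr_fun
      ((integrableOn_rpow_mul_exp_neg_mul_Ioi hα hL).const_mul (1 / (s * Real.Gamma α)))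
      (fun x hx => ?_) measurableSet_Ioi
    rw [← integral_volterraKernel hc hs₀ hx]
    exact setIntegral_congr_fun measurableSet_Ioi fun u hu =>
      (Real.norm_of_nonneg (volterraKernel_nonneg hα hc hx hu)).symm
  · rw [Measure.prod_restrict]
    exact (continuousOn_volterraKernel hα hc).aestronglyMeasurable
      (measurableSet_Ioi.prod measurableSet_Ioi)

/-- The Laplace transform of `u ↦ volterraMu (c * u) (α - 1)`. -/
theorem integral_exp_neg_mul_volterraMu {α c s : ℝ} (hα : 0 < α) (hc : 0 < c) (hs : c < s) :
    ∫ u in Ioi (0:ℝ), Real.exp (-s * u) * volterraMu (c * u) (α - 1) =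
      1 / (s * Real.log (s / c) ^ α) := by
  have hs₀ : 0 < s := hc.trans hs
  have hL : 0 < Real.log (s / c) := Real.log_pos ((one_lt_div hc).2 hs)
  have hΓ := Real.Gamma_pos_of_pos hα
  calc
    _ = ∫ u in Ioi (0:ℝ), ∫ x in Ioi (0:ℝ), volterraKernel α c s x u := by
      simp only [volterraMu, volterraKernel, integral_const_mul]
    _ = ∫ x in Ioi (0:ℝ), ∫ u in Ioi (0:ℝ), volterraKernel α c s x u :=
      (integral_integral_swap (integrable_uncurry_volterraKernel hα hc hs)).symm
    _ = 1 / (s * Real.Gamma α) * ((1 / Real.log (s / c)) ^ α * Real.Gamma α) := by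
      rw [setIntegral_congr_fun measurableSet_Ioi fun _ hx => integral_volterraKernel hc hs₀ hx,
        integral_const_mul, Real.integral_rpow_mul_exp_neg_mul_Ioi hα hL]
    _ = 1 / (s * Real.log (s / c) ^ α) := by
      rw [Real.div_rpow zero_le_one hL.le, Real.one_rpow]
      field_simp

/-- For `α > 0` and every `s > e^(-(1+γ))` (`γ` the Euler–Mascheroni constant),
`∫_0^∞ e^(-s u) μ(e^(-(1+γ)) u, α - 1) du = 1/(s (1 + γ + log s)^α)`;
i.e. `u ↦ μ(e^(-(1+γ)) u, α-1)` is the inverse Laplace transform of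
`1/(s ln^α(e^(1+γ) s))`. -/
theorem stmt_6 (α : ℝ) (hα : 0 < α) (s : ℝ)
    (hs : Real.exp (-(1 + Real.eulerMascheroniConstant)) < s) :
    ∫ u in Set.Ioi (0:ℝ),
        Real.exp (-s * u) *
          volterraMu (Real.exp (-(1 + Real.eulerMascheroniConstant)) * u) (α - 1)
      = 1 / (s * (1 + Real.eulerMascheroniConstant + Real.log s) ^ α) := by
  have hs₀ : s ≠ 0 := ((Real.exp_pos _).trans hs).ne'
  rw [integral_exp_neg_mul_volterraMu hα (Real.exp_pos _) hs,
    Real.log_div hs₀ (Real.exp_ne_zero _), Real.log_exp, sub_neg_eq_add, add_comm (Real.log s)]
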